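/- arXiv:2305.06256 — 2 statements merged into one kernel-verified Lean document; each statement's English description precedes it below -/
import Mathlib

section
/- Assume each utility u_i is continuous, strictly increasing, quasiconcave, and differentiable on the interior of ℝ_{≥0}^K. Then every minimal element of the VPS belongs to the UPS: if p ∈ Σ_K^+(w) and m ∈ Σ_N are such that (v_1(p,m_1),…,v_N(p,m_N)) is a minimal element of the VPS, then there exists a feasible allocation x ∈ F(w) with u_i(x_i) = v_i(p,m_i) and ⟨p,x_i⟩ = m_i for every i; in particular the consumers' optimal demands at (p,m) are jointly feasible. -/
/-- Euclidean inner product on `ℝ^K`. -/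
noncomputable def dot {K : ℕ} (p x : Fin K → ℝ) : ℝ := ∑ k, p k * x k

/-- Membership in the nonnegative orthant `ℝ_{≥0}^K`. -/
def nonneg {K : ℕ} (x : Fin K → ℝ) : Prop := ∀ k, 0 ≤ x k

/-- Strictly positive price vector. -/
def posVec {K : ℕ} (p : Fin K → ℝ) : Prop := ∀ k, 0 < p k

/-- `v` is the indirect utility of `u`: for every strictly positive price `p` and income
`m ≥ 0`, `v p m` is the maximum of `u` over the budget set
`{x ∈ ℝ_{≥0}^K : ⟨p,x⟩ ≤ m}`. -/
def IsIndirectUtility {K : ℕ} (u : (Fin K → ℝ) → ℝ) (v : (Fin K → ℝ) → ℝ → ℝ) : Prop :=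
  ∀ p m, posVec p → 0 ≤ m →
    IsGreatest {t | ∃ x, nonneg x ∧ dot p x ≤ m ∧ u x = t} (v p m)

/-- The set of feasible allocations `F(w)`. -/
def Feasible {K N : ℕ} (w : Fin K → ℝ) (x : Fin N → Fin K → ℝ) : Prop :=
  (∀ i, nonneg (x i)) ∧ ∀ k, (∑ i, x i k) ≤ w k

/-- Normalized strictly positive prices `Σ_K^+(w)`. -/
def PriceSimplex {K : ℕ} (w p : Fin K → ℝ) : Prop := posVec p ∧ dot p w = 1

/-- Income distributions `Σ_N`. -/
def IncomeSimplex {N : ℕ} (m : Fin N → ℝ) : Prop := (∀ i, 0 ≤ m i) ∧ (∑ i, m i) = 1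

/-- The utility possibility set. -/
def UPS {K N : ℕ} (w : Fin K → ℝ) (u : Fin N → (Fin K → ℝ) → ℝ) : Set (Fin N → ℝ) :=
  {e | ∃ x, Feasible w x ∧ ∀ i, e i = u i (x i)}

/-- The indirect utility possibility set. -/
def VPS {K N : ℕ} (w : Fin K → ℝ) (v : Fin N → (Fin K → ℝ) → ℝ → ℝ) : Set (Fin N → ℝ) :=
  {e | ∃ p m, PriceSimplex w p ∧ IncomeSimplex m ∧ ∀ i, e i = v i p (m i)}

/-- A Walrasian equilibrium with income distribution `m`. -/
def WalrasEq {K N : ℕ} (w : Fin K → ℝ) (u : Fin N → (Fin K → ℝ) → ℝ)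
    (v : Fin N → (Fin K → ℝ) → ℝ → ℝ)
    (x : Fin N → Fin K → ℝ) (p : Fin K → ℝ) (m : Fin N → ℝ) : Prop :=
  Feasible w x ∧ PriceSimplex w p ∧ ∀ i, dot p (x i) = m i ∧ u i (x i) = v i p (m i)

/-- Pareto optimality of an allocation `x ∈ F(w)`. -/
def ParetoOptimal {K N : ℕ} (w : Fin K → ℝ) (u : Fin N → (Fin K → ℝ) → ℝ)
    (x : Fin N → Fin K → ℝ) : Prop :=
  Feasible w x ∧
    ¬ ∃ x', Feasible w x' ∧ (∀ i, u i (x i) ≤ u i (x' i)) ∧ ∃ j, u j (x j) < u j (x' j)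

open Filter Topology

section Dot

variable {K : ℕ}

lemma dot_add_left (p q x : Fin K → ℝ) : dot (p + q) x = dot p x + dot q x := by
  simp [dot, add_mul, Finset.sum_add_distrib]

lemma dot_smul_left (t : ℝ) (p x : Fin K → ℝ) : dot (t • p) x = t * dot p x := by
  simp [dot, mul_assoc, Finset.mul_sum]

lemma dot_add_right (p x y : Fin K → ℝ) : dot p (x + y) = dot p x + dot p y := by
  simp [dot, mul_add, Finset.sum_add_distrib]

lemma dot_smul_right (t : ℝ) (p x : Fin K → ℝ) : dot p (t • x) = t * dot p x := by
  simp only [dot, Pi.smul_apply, smul_eq_mul, Finset.mul_sum]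
  exact Finset.sum_congr rfl fun k _ => by ring

lemma dot_sum_right {N : ℕ} (p : Fin K → ℝ) (x : Fin N → Fin K → ℝ) :
    dot p (∑ i, x i) = ∑ i, dot p (x i) := by
  simp only [dot, Finset.sum_apply, Finset.mul_sum]
  exact Finset.sum_comm

lemma continuous_dot (p : Fin K → ℝ) : Continuous (dot p) := by
  unfold dot; fun_prop

lemma mul_le_dot {p x : Fin K → ℝ} (hp : nonneg p) (hx : nonneg x) (k : Fin K) :
    p k * x k ≤ dot p x :=
  Finset.single_le_sum (f := fun k => p k * x k)
    (fun j _ => mul_nonneg (hp j) (hx j)) (Finset.mem_univ k)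

lemma eq_zero_of_dot_nonpos {p x : Fin K → ℝ} (hp : posVec p) (hx : nonneg x)
    (h : dot p x ≤ 0) : x = 0 := by
  funext k
  have h1 := mul_le_dot (fun j => (hp j).le) hx k
  have h2 : x k ≤ 0 := by
    by_contra! hk
    have := mul_pos (hp k) hk
    linarith
  exact le_antisymm h2 (hx k)

end Dot

/-- The optimal bundles of `u` at prices `p` and income `m`, given the indirect utility `v`. -/
def demand {K : ℕ} (u : (Fin K → ℝ) → ℝ) (v : (Fin K → ℝ) → ℝ → ℝ) (p : Fin K → ℝ) (m : ℝ) :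
    Set (Fin K → ℝ) :=
  {x | (nonneg x ∧ v p m ≤ u x) ∧ dot p x ≤ m}

section Consumer

variable {K : ℕ} {u : (Fin K → ℝ) → ℝ} {v : (Fin K → ℝ) → ℝ → ℝ} {p : Fin K → ℝ} {m : ℝ}

lemma demand_nonempty (hv : IsIndirectUtility u v) (hp : posVec p) (hm : 0 ≤ m) :
    (demand u v p m).Nonempty := by
  obtain ⟨x, hx, hpx, hux⟩ := (hv p m hp hm).1
  exact ⟨x, ⟨hx, hux.ge⟩, hpx⟩

lemma convex_demand (hqc : ∀ c : ℝ, Convex ℝ {x | nonneg x ∧ c ≤ u x}) :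
    Convex ℝ (demand u v p m) := by
  refine (hqc (v p m)).inter (t := {x | dot p x ≤ m}) fun x hx y hy a b ha hb hab => ?_
  simp only [Set.mem_ofPred_eq, dot_add_right, dot_smul_right] at *
  calc a * dot p x + b * dot p y ≤ a * m + b * m := by gcongr
    _ = m := by rw [← add_mul, hab, one_mul]

lemma isCompact_Icc_inter_superlevel (hc : ContinuousOn u {x | nonneg x}) (B : Fin K → ℝ) (r : ℝ) :
    IsCompact (Set.Icc 0 B ∩ u ⁻¹' Set.Ici r) :=
  (isCompact_Icc).of_isClosed_subset
    ((hc.mono fun _ hx => hx.1).preimage_isClosed_of_isClosed isClosed_Icc isClosed_Ici)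
    Set.inter_subset_left

lemma isCompact_demand (hc : ContinuousOn u {x | nonneg x}) (hp : posVec p) :
    IsCompact (demand u v p m) := by
  have h := (isCompact_Icc_inter_superlevel hc (fun k => m / p k) (v p m)).inter_right
    (isClosed_le (continuous_dot p) (continuous_const (y := m)))
  convert h using 1
  ext x
  constructor
  · rintro ⟨⟨hx, hux⟩, hpx⟩
    refine ⟨⟨⟨hx, fun k => ?_⟩, hux⟩, hpx⟩
    rw [le_div_iff₀' (hp k)]
    exact (mul_le_dot (fun j => (hp j).le) hx k).trans hpx
  · rintro ⟨⟨⟨hx, -⟩, hux⟩, hpx⟩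
    exact ⟨⟨hx, hux⟩, hpx⟩

/-- A bundle at least as good as the optimal ones costs at least the income. -/
lemma le_dot_of_le_utility (hK : 1 ≤ K)
    (hmono : ∀ x y, nonneg x → nonneg y → (∀ k, x k ≤ y k) → x ≠ y → u x < u y)
    (hv : IsIndirectUtility u v) (hp : posVec p) (hm : 0 ≤ m)
    {y : Fin K → ℝ} (hy : nonneg y) (huy : v p m ≤ u y) : m ≤ dot p y := by
  by_contra! hlt
  let k₀ : Fin K := ⟨0, hK⟩
  let ε := (m - dot p y) / p k₀
  have hε : 0 < ε := div_pos (by linarith) (hp k₀)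
  have hle : ∀ k, y k ≤ (y + Pi.single k₀ ε : Fin K → ℝ) k := fun k => by
    have : (0 : Fin K → ℝ) k ≤ (Pi.single k₀ ε : Fin K → ℝ) k :=
      (Pi.single_nonneg.2 hε.le) k
    simpa using this
  have hne : y ≠ y + Pi.single k₀ ε := fun h => by
    have := congrFun h k₀
    simp at this
    linarith
  have hy' : nonneg (y + Pi.single k₀ ε) := fun k => (hy k).trans (hle k)
  have hcost : dot p (y + Pi.single k₀ ε) ≤ m := by
    have h1 : dot p (Pi.single k₀ ε) = p k₀ * ε := by
      simp [dot, Pi.single_apply]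
    rw [dot_add_right, h1, mul_div_cancel₀ _ (hp k₀).ne']
    linarith
  have h2 := (hv p m hp hm).2 ⟨_, hy', hcost, rfl⟩
  have h3 := hmono _ _ hy hy' hle hne
  linarith

lemma indirectUtility_zero (hv : IsIndirectUtility u v) (hp : posVec p) : v p 0 = u 0 := by
  obtain ⟨x, hx, hpx, hux⟩ := (hv p 0 hp le_rfl).1
  rw [← hux, eq_zero_of_dot_nonpos hp hx hpx]

lemma eventually_half_le (hp : posVec p) (d : Fin K → ℝ) :
    ∀ᶠ t : ℝ in 𝓝 0, ∀ k, p k / 2 < (p + t • d) k := by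
  rw [eventually_all]
  intro k
  have h : Continuous fun t : ℝ => (p + t • d) k := by
    simp only [Pi.add_apply, Pi.smul_apply]; fun_prop
  refine h.tendsto 0 |>.eventually (lt_mem_nhds ?_)
  simpa using hp k

lemma eventually_add_mul_mem {m : ℝ} (hm : 0 < m) (c : ℝ) :
    ∀ᶠ t : ℝ in 𝓝 0, 0 < m + t * c ∧ m + t * c < m + 1 := by
  have h : Continuous fun t : ℝ => m + t * c := by fun_prop
  exact h.tendsto 0 |>.eventually (Ioo_mem_nhds (by simpa using hm) (by simp))

/-- If income rises less than the cost of every optimal bundle when prices move in the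
direction `d`, then the consumer is made strictly worse off by a small move. -/
lemma eventually_indirectUtility_lt (hK : 1 ≤ K) (hcont : ContinuousOn u {x | nonneg x})
    (hmono : ∀ x y, nonneg x → nonneg y → (∀ k, x k ≤ y k) → x ≠ y → u x < u y)
    (hv : IsIndirectUtility u v) (hp : posVec p) (hm : 0 < m) (d : Fin K → ℝ) (c : ℝ)
    (hc : ∀ y ∈ demand u v p m, c < dot d y) :
    ∀ᶠ t : ℝ in 𝓝[>] 0, v (p + t • d) (m + t * c) < v p m := by
  let B : Fin K → ℝ := fun k => (m + 1) / (p k / 2)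
  let S : Set (ℝ × (Fin K → ℝ)) :=
    (Set.Icc 0 1 ×ˢ (Set.Icc 0 B ∩ u ⁻¹' Set.Ici (v p m))) ∩
      ({q | dot p q.2 + q.1 * dot d q.2 ≤ m + q.1 * c} ∩ {q | dot d q.2 ≤ c})
  have hd := (continuous_dot d).comp (continuous_snd (X := ℝ))
  have hp' := (continuous_dot p).comp (continuous_snd (X := ℝ))
  simp only [Function.comp_def] at hd hp'
  have hS : IsCompact S := by
    refine (isCompact_Icc.prod (isCompact_Icc_inter_superlevel hcont B _)).inter_right
      (IsClosed.inter (isClosed_le ?_ ?_) (isClosed_le hd continuous_const)) <;> fun_prop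
  have hS0 : (0 : ℝ) ∉ Prod.fst '' S := by
    rintro ⟨⟨t, y⟩, ⟨⟨-, ⟨hy, -⟩, huy⟩, hcost, hdy⟩, rfl⟩
    have := hc y ⟨⟨hy, huy⟩, by simpa using hcost⟩
    exact absurd hdy (not_le.2 this)
  have hev : ∀ᶠ t : ℝ in 𝓝 0, t ∉ Prod.fst '' S :=
    (hS.image continuous_fst).isClosed.isOpen_compl.mem_nhds hS0
  filter_upwards [nhdsWithin_le_nhds hev, nhdsWithin_le_nhds (eventually_half_le hp d),
    nhdsWithin_le_nhds (eventually_add_mul_mem hm c),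
    nhdsWithin_le_nhds (gt_mem_nhds (zero_lt_one' ℝ)), self_mem_nhdsWithin]
    with t htS hhalf hmt ht1 ht0
  by_contra! hge
  have hpt : posVec (p + t • d) := fun k => (half_pos (hp k)).trans (hhalf k)
  obtain ⟨y, hy, hcost, huy⟩ := (hv _ _ hpt hmt.1.le).1
  rw [← huy] at hge
  have hexp := le_dot_of_le_utility hK hmono hv hp hm.le hy hge
  have hB : ∀ k, y k ≤ B k := fun k => by
    rw [le_div_iff₀' (half_pos (hp k))]
    calc p k / 2 * y k ≤ (p + t • d) k * y k :=
          mul_le_mul_of_nonneg_right (hhalf k).le (hy k)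
      _ ≤ _ := mul_le_dot (fun j => (hpt j).le) hy k
      _ ≤ m + 1 := hcost.trans hmt.2.le
  rw [dot_add_left, dot_smul_left] at hcost
  have hdy : dot d y ≤ c := le_of_mul_le_mul_left (by linarith) (Set.mem_Ioi.1 ht0)
  exact htS ⟨(t, y), ⟨⟨⟨(Set.mem_Ioi.1 ht0).le, le_of_lt ht1⟩, ⟨hy, hB⟩, hge⟩, hcost, hdy⟩, rfl⟩

end Consumer

/-- A point of the budget hyperplane outside a closed convex subset of it is separated from it
by a functional vanishing at the point. -/
lemma exists_dot_pos_of_notMem {K : ℕ} {Z : Set (Fin K → ℝ)} (hZ : Convex ℝ Z)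
    (hZc : IsClosed Z) {p w : Fin K → ℝ} (hpw : dot p w = 1) (hpZ : ∀ z ∈ Z, dot p z = 1)
    (hw : w ∉ Z) : ∃ d, dot d w = 0 ∧ ∀ z ∈ Z, 0 < dot d z := by
  obtain ⟨f, r, hfw, hfz⟩ := geometric_hahn_banach_point_closed hZ hZc hw
  let a : Fin K → ℝ := fun k => f (Pi.single k 1)
  have hf : ∀ x, dot a x = f x := fun x => by
    conv_rhs => rw [pi_eq_sum_univ' x]
    simp only [map_sum, map_smul, smul_eq_mul, dot, a]
    refine Finset.sum_congr rfl fun k _ => ?_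
    exact mul_comm _ _
  refine ⟨a + (-f w) • p, ?_, fun z hz => ?_⟩
  · rw [dot_add_left, dot_smul_left, hf, hpw]; ring
  · rw [dot_add_left, dot_smul_left, hf, hpZ z hz]
    linarith [hfz z hz]

/-- Lemma A2, first part: every minimal element of the VPS belongs to the
UPS; the optimal demands at `(p,m)` are jointly feasible. -/
theorem minimal_VPS_mem_UPS {K N : ℕ} (hK : 1 ≤ K) (hN : 1 ≤ N)
    (w : Fin K → ℝ) (hw : posVec w)
    (u : Fin N → (Fin K → ℝ) → ℝ)
    (hu_cont : ∀ i, ContinuousOn (u i) {x | nonneg x})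
    (hu_mono : ∀ i x y, nonneg x → nonneg y → (∀ k, x k ≤ y k) → x ≠ y → u i x < u i y)
    (hu_qc : ∀ i (c : ℝ), Convex ℝ {x | nonneg x ∧ c ≤ u i x})
    (hu_diff : ∀ i, DifferentiableOn ℝ (u i) {x | posVec x})
    (v : Fin N → (Fin K → ℝ) → ℝ → ℝ)
    (hv : ∀ i, IsIndirectUtility (u i) (v i)) :
    ∀ p m, PriceSimplex w p → IncomeSimplex m →
      (fun i => v i p (m i)) ∈ VPS w v →
      (∀ e' ∈ VPS w v, (∀ i, e' i ≤ v i p (m i)) → e' = fun i => v i p (m i)) →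
      ∃ x, Feasible w x ∧ ∀ i, u i (x i) = v i p (m i) ∧ dot p (x i) = m i := by
  intro p m hp hm _ hmin
  obtain ⟨hp0, hpw⟩ := hp
  obtain ⟨hm0, hm1⟩ := hm
  let D : Fin N → Set (Fin K → ℝ) := fun i => demand (u i) (v i) p (m i)
  have hbudget : ∀ i, ∀ x ∈ D i, dot p x = m i := fun i x hx =>
    hx.2.antisymm (le_dot_of_le_utility hK (hu_mono i) (hv i) hp0 (hm0 i) hx.1.1 hx.1.2)
  let Z : Set (Fin K → ℝ) := (fun x : Fin N → Fin K → ℝ => ∑ i, x i) '' Set.univ.pi D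
  have hZconv : Convex ℝ Z :=
    (convex_pi fun i _ => convex_demand (hu_qc i)).is_linear_image
      ⟨fun x y => by simp [Finset.sum_add_distrib], fun c x => by simp [Finset.smul_sum]⟩
  have hZcomp : IsCompact Z :=
    (isCompact_univ_pi fun i => isCompact_demand (hu_cont i) hp0).image (by fun_prop)
  have hpZ : ∀ z ∈ Z, dot p z = 1 := by
    rintro _ ⟨x, hx, rfl⟩
    rw [dot_sum_right, ← hm1]
    exact Finset.sum_congr rfl fun i _ => hbudget i _ (hx i trivial)
  by_cases hwZ : w ∈ Z
  · obtain ⟨x, hx, hxw⟩ := hwZ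
    refine ⟨x, ⟨fun i => (hx i trivial).1.1, fun k => ?_⟩, fun i => ⟨?_, ?_⟩⟩
    · simp [← hxw, Finset.sum_apply]
    · have hxi := hx i trivial
      exact le_antisymm ((hv i p (m i) hp0 (hm0 i)).2 ⟨_, hxi.1.1, hxi.2, rfl⟩) hxi.1.2
    · exact hbudget i _ (hx i trivial)
  exfalso
  obtain ⟨d, hdw, hdZ⟩ := exists_dot_pos_of_notMem hZconv hZcomp.isClosed hpw hpZ hwZ
  have hcheapest : ∀ i, ∃ x ∈ D i, IsMinOn (dot d) (D i) x := fun i =>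
    (isCompact_demand (hu_cont i) hp0).exists_isMinOn
      (demand_nonempty (hv i) hp0 (hm0 i)) (continuous_dot d).continuousOn
  choose x hxD hxmin using hcheapest
  let s := dot d (∑ i, x i)
  have hs : 0 < s := hdZ _ ⟨x, fun i _ => hxD i, rfl⟩
  let c : Fin N → ℝ := fun i => dot d (x i) - s * m i
  have hc : ∑ i, c i = 0 := by
    simp only [c, Finset.sum_sub_distrib, ← Finset.mul_sum, hm1, ← dot_sum_right]
    simp [s]
  have hc0 : ∀ i, m i = 0 → c i = 0 := fun i hi => by
    have hx0 : x i = 0 := eq_zero_of_dot_nonpos hp0 (hxD i).1.1 ((hxD i).2.trans hi.le)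
    simp [c, hi, hx0, dot]
  have hworse : ∀ i, 0 < m i →
      ∀ᶠ t : ℝ in 𝓝[>] 0, v i (p + t • d) (m i + t * c i) < v i p (m i) := fun i hi =>
    eventually_indirectUtility_lt hK (hu_cont i) (hu_mono i) (hv i) hp0 hi d (c i)
      fun y hy => by
        have := hxmin i hy
        have := mul_pos hs hi
        simp only [Set.mem_ofPred_eq, c] at *
        linarith
  have hall : ∀ᶠ t : ℝ in 𝓝[>] 0, ∀ i, 0 < m i →
      0 < m i + t * c i ∧ v i (p + t • d) (m i + t * c i) < v i p (m i) := by
    rw [eventually_all]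
    intro i
    by_cases hi : 0 < m i
    · filter_upwards [hworse i hi, nhdsWithin_le_nhds (eventually_add_mul_mem hi (c i))]
        with t h1 h2 _
      exact ⟨h2.1, h1⟩
    · exact Eventually.of_forall fun t h => absurd h hi
  obtain ⟨t, ht, hhalf⟩ :=
    (hall.and (nhdsWithin_le_nhds (eventually_half_le hp0 d))).exists
  have hpt : posVec (p + t • d) := fun k => (half_pos (hp0 k)).trans (hhalf k)
  have hzero : ∀ i, ¬ 0 < m i → m i = 0 := fun i hi => le_antisymm (not_lt.1 hi) (hm0 i)
  have heq := hmin (fun i => v i (p + t • d) (m i + t * c i))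
    ⟨p + t • d, fun i => m i + t * c i,
      ⟨hpt, by rw [dot_add_left, dot_smul_left, hpw, hdw]; ring⟩,
      ⟨fun i => ?_, by rw [Finset.sum_add_distrib, ← Finset.mul_sum, hm1, hc]; ring⟩,
      fun i => rfl⟩ fun i => ?_
  · obtain ⟨j, hj⟩ : ∃ j, 0 < m j := by
      by_contra! h
      have := Finset.sum_nonpos fun i (_ : i ∈ Finset.univ) => h i
      linarith
    exact (ht j hj).2.ne (congrFun heq j)
  · by_cases hi : 0 < m i
    · exact (ht i hi).1.le
    · simp [hzero i hi, hc0 i (hzero i hi)]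
  · by_cases hi : 0 < m i
    · exact (ht i hi).2.le
    · simp only [hzero i hi, hc0 i (hzero i hi), mul_zero, add_zero]
      rw [indirectUtility_zero (hv i) hpt, indirectUtility_zero (hv i) hp0]
end

section
/- (Bilateral trade: E(ω) = Ē(ω).) Let N = 2 and let ω_1, ω_2 ∈ ℝ_{≥0}^K be endowments with ω_1 + ω_2 = w. Assume u_1 and u_2 are continuous and strictly increasing. If x = (x_1,x_2) ∈ F(w) is Pareto optimal and individually rational (u_i(x_i) ≥ u_i(ω_i) for i = 1,2), then x is consistent with linear and anonymous prices: there exists p ∈ ℝ_{≥0}^K with ⟨p,w⟩ = 1 such that ⟨p,x_1⟩ = ⟨p,ω_1⟩ and ⟨p,x_2⟩ = ⟨p,ω_2⟩. -/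
/-- Feasibility for a two-consumer allocation. -/
def Feasible2 {K : ℕ} (w x1 x2 : Fin K → ℝ) : Prop :=
  nonneg x1 ∧ nonneg x2 ∧ ∀ k, x1 k + x2 k ≤ w k

/-- A vector which is zero or has coordinates of both signs is orthogonal to a nonzero
nonnegative vector. -/
theorem exists_nonneg_dot_eq_zero {K : ℕ} (hK : 1 ≤ K) (z : Fin K → ℝ)
    (hpos : nonneg z → z = 0) (hneg : nonneg (-z) → z = 0) :
    ∃ p : Fin K → ℝ, nonneg p ∧ p ≠ 0 ∧ dot p z = 0 := by
  by_cases hz : z = 0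
  · refine ⟨fun _ => 1, fun _ => zero_le_one, fun h => ?_, by simp [dot, hz]⟩
    exact one_ne_zero (congrFun h ⟨0, hK⟩)
  · have hj : ∃ j, z j < 0 := by
      by_contra! h
      exact hz (hpos h)
    have hi : ∃ i, 0 < z i := by
      by_contra! h
      exact hz (hneg fun k => by simpa using h k)
    obtain ⟨j, hj⟩ := hj
    obtain ⟨i, hi⟩ := hi
    have hij : i ≠ j := by
      rintro rfl
      exact lt_asymm hi hj
    refine ⟨Pi.single i (-z j) + Pi.single j (z i), fun k => ?_, fun h => ?_, ?_⟩
    · refine add_nonneg ?_ ?_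
      · exact (Pi.single_nonneg.2 (neg_nonneg.2 hj.le) : (0 : Fin K → ℝ) ≤ _) k
      · exact (Pi.single_nonneg.2 hi.le : (0 : Fin K → ℝ) ≤ _) k
    · have := congrFun h i
      simp [hij] at this
      exact hj.ne this
    · simp only [dot, Pi.add_apply, add_mul, Finset.sum_add_distrib]
      simp [Pi.single_apply, ite_mul]
      ring

theorem dot_pos {K : ℕ} {p w : Fin K → ℝ} (hp : nonneg p) (hp0 : p ≠ 0) (hw : posVec w) :
    0 < dot p w := by
  obtain ⟨k, hk⟩ := Function.ne_iff.1 hp0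
  exact Finset.sum_pos' (fun i _ => mul_nonneg (hp i) (hw i).le)
    ⟨k, Finset.mem_univ k, mul_pos (lt_of_le_of_ne (hp k) (Ne.symm hk)) (hw k)⟩

theorem smul_dot {K : ℕ} (c : ℝ) (p x : Fin K → ℝ) : dot (c • p) x = c * dot p x := by
  simp [dot, Finset.mul_sum, mul_assoc]

theorem dot_sub {K : ℕ} (p x y : Fin K → ℝ) : dot p (x - y) = dot p x - dot p y := by
  simp [dot, mul_sub]

/-- bilateral trade, `E(ω) = Ē(ω)`: with two consumers, any individually
rational Pareto optimal allocation is consistent with linear and anonymous prices. -/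
theorem bilateral_pareto_consistent_with_linear_prices {K : ℕ} (hK : 1 ≤ K)
    (w : Fin K → ℝ) (hw : posVec w)
    (u1 u2 : (Fin K → ℝ) → ℝ)
    (hu1_cont : ContinuousOn u1 {x | nonneg x})
    (hu2_cont : ContinuousOn u2 {x | nonneg x})
    (hu1_mono : ∀ x y, nonneg x → nonneg y → (∀ k, x k ≤ y k) → x ≠ y → u1 x < u1 y)
    (hu2_mono : ∀ x y, nonneg x → nonneg y → (∀ k, x k ≤ y k) → x ≠ y → u2 x < u2 y)
    (ω1 ω2 : Fin K → ℝ) (hω1 : nonneg ω1) (hω2 : nonneg ω2)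
    (hωsum : ∀ k, ω1 k + ω2 k = w k)
    (x1 x2 : Fin K → ℝ) (hx : Feasible2 w x1 x2)
    -- Pareto optimality
    (hpo : ¬ ∃ x1' x2', Feasible2 w x1' x2' ∧
      (u1 x1 ≤ u1 x1' ∧ u2 x2 ≤ u2 x2') ∧ (u1 x1 < u1 x1' ∨ u2 x2 < u2 x2'))
    -- individual rationality
    (hir1 : u1 ω1 ≤ u1 x1) (hir2 : u2 ω2 ≤ u2 x2) :
    ∃ p : Fin K → ℝ, nonneg p ∧ dot p w = 1 ∧
      dot p x1 = dot p ω1 ∧ dot p x2 = dot p ω2 := by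
  obtain ⟨hx1, hx2, hle⟩ := hx
  have hsum : ∀ k, x1 k + x2 k = w k := by
    by_contra! ⟨i, hi⟩
    have hlt : u1 x1 < u1 (w - x2) := by
      refine hu1_mono _ _ hx1 (fun k => ?_) (fun k => ?_) (fun h => hi ?_)
      · simpa using (by linarith [hx1 k, hle k] : x2 k ≤ w k)
      · simpa using le_sub_iff_add_le.2 (hle k)
      · simpa using eq_sub_iff_add_eq.1 (congrFun h i)
    refine hpo ⟨w - x2, x2, ⟨fun k => ?_, hx2, fun k => ?_⟩, ⟨hlt.le, le_rfl⟩, Or.inl hlt⟩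
    · simpa using (by linarith [hx1 k, hle k] : x2 k ≤ w k)
    · simp
  have hnet : x2 - ω2 = ω1 - x1 := by
    ext k
    simp only [Pi.sub_apply]
    linarith [hsum k, hωsum k]
  obtain ⟨p, hp, hp0, hpz⟩ := exists_nonneg_dot_eq_zero hK (x1 - ω1)
    (fun h => by
      by_contra hz
      refine (hu2_mono x2 ω2 hx2 hω2 (fun k => ?_) (fun h2 => hz ?_)).not_ge hir2
      · have := h k
        simp only [Pi.sub_apply] at this
        linarith [hsum k, hωsum k]
      · rw [← neg_sub, ← hnet, h2, sub_self, neg_zero])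
    (fun h => by
      by_contra hz
      refine (hu1_mono x1 ω1 hx1 hω1 (fun k => ?_) (fun h1 => hz ?_)).not_ge hir1
      · simpa using h k
      · rw [h1, sub_self])
  have hpw := dot_pos hp hp0 hw
  have h1 : dot p x1 = dot p ω1 := by
    rw [dot_sub] at hpz
    exact sub_eq_zero.1 hpz
  have h2 : dot p x2 = dot p ω2 := by
    rw [← sub_eq_zero, ← dot_sub, hnet, dot_sub, h1, sub_self]
  refine ⟨(dot p w)⁻¹ • p, fun k => mul_nonneg (inv_nonneg.2 hpw.le) (hp k), ?_, ?_, ?_⟩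
  · rw [smul_dot, inv_mul_cancel₀ hpw.ne']
  · rw [smul_dot, smul_dot, h1]
  · rw [smul_dot, smul_dot, h2]
end
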